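/- arXiv:2310.09702 — 3 statements merged into one kernel-verified Lean document; each statement's English description precedes it below -/
import Mathlib

section
/- Fix integers d ≥ 1, B_0 ≥ 1 and k_1, …, k_{B_0} ≥ 1, set k = Σ_{b=1}^{B_0} k_b, and fix x ∈ (0,1)^d. Let f be a Lebesgue probability density on [0,1]^d that is bounded above and bounded away from zero, and let (λ_n) be positive reals with λ_n^d/n → 0 and log λ_n ≍ log n. For each n, let T_1(x), …, T_{B_0}(x) be independent Mondrian cells at x with lifetime λ_n, let X_1, …, X_n be i.i.d. with density f, independent of the cells, and set N_b(x) = #{1 ≤ i ≤ n : X_i ∈ T_b(x)}. Then for all sufficiently large n, E[ ∏_{b=1}^{B_0} 1{N_b(x) ≥ 1} / N_b(x)^{k_b} ] ≤ (36 k / inf_{[0,1]^d} f)^{2^{B_0} k} ∏_{b=1}^{B_0} E[ min(1, 1/(n |T_b(x)|)^{k_b}) ]. -/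
open MeasureTheory ProbabilityTheory Filter
open scoped ENNReal NNReal Topology Classical

noncomputable section

/-- A standard Exponential(1) random variable: `P(E > t) = e^{-t}` for all `t ≥ 0`. -/
def IsExpOne {Ω : Type*} [MeasurableSpace Ω] (P : Measure Ω) (E : Ω → ℝ) : Prop :=
  Measurable E ∧ ∀ t : ℝ, 0 ≤ t → P {ω | t < E ω} = ENNReal.ofReal (Real.exp (-t))

/-- The closed unit box `[0,1]^d`. -/
def unitBox (d : ℕ) : Set (Fin d → ℝ) := Set.univ.pi fun _ => Set.Icc (0 : ℝ) 1

/-- The `j`-th side length of the Mondrian cell at `x` with lifetime `lam` generated by the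
lower exponentials `lo` and the upper exponentials `hi`. -/
def mondrianSide {d : ℕ} (x : Fin d → ℝ) (lam : ℝ) (lo hi : Fin d → ℝ) (j : Fin d) : ℝ :=
  min (lo j / lam) (x j) + min (hi j / lam) (1 - x j)

/-- The volume `|T(x)|` of the Mondrian cell at `x`. -/
def mondrianVol {d : ℕ} (x : Fin d → ℝ) (lam : ℝ) (lo hi : Fin d → ℝ) : ℝ :=
  ∏ j, mondrianSide x lam lo hi j

/-- `z` lies in the Mondrian cell at `x` with lifetime `lam` generated by `lo`, `hi`. -/
def inMondrianCell {d : ℕ} (x : Fin d → ℝ) (lam : ℝ) (lo hi : Fin d → ℝ)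
    (z : Fin d → ℝ) : Prop :=
  ∀ j, x j - min (lo j / lam) (x j) ≤ z j ∧ z j ≤ x j + min (hi j / lam) (1 - x j)

lemma md_asc_le (N : ℕ) (hN : 1 ≤ N) (k : ℕ) :
    (N + 1).ascFactorial k ≤ (k + 1).factorial * N ^ k := by
  induction k with
  | zero => simp
  | succ k ih =>
    rw [Nat.ascFactorial_succ, Nat.factorial_succ (k + 1), pow_succ]
    have h : N + 1 + k ≤ (k + 1 + 1) * N := by nlinarith
    calc (N + 1 + k) * (N + 1).ascFactorial k
        ≤ ((k + 1 + 1) * N) * ((k + 1).factorial * N ^ k) := Nat.mul_le_mul h ih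
      _ = _ := by ring

lemma md_choose_asc (n j k : ℕ) (hj : j ≤ n) :
    n.choose j * (n + 1).ascFactorial k = (n + k).choose (j + k) * (j + 1).ascFactorial k := by
  have h1 := Nat.choose_mul_factorial_mul_factorial hj
  have h2 := Nat.choose_mul_factorial_mul_factorial (Nat.add_le_add_right hj k)
  have h3 := Nat.factorial_mul_ascFactorial n k
  have h4 := Nat.factorial_mul_ascFactorial j k
  have h5 : n + k - (j + k) = n - j := by omega
  rw [h5] at h2
  have hp : 0 < j.factorial * (n - j).factorial :=
    Nat.mul_pos (Nat.factorial_pos _) (Nat.factorial_pos _)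
  apply Nat.eq_of_mul_eq_mul_right hp
  calc _ = (n.choose j * j.factorial * (n - j).factorial) * (n + 1).ascFactorial k := by ring
    _ = (n + k).choose (j + k) * (j.factorial * (j + 1).ascFactorial k) * (n - j).factorial := by
        rw [h1, h3, h4, h2]
    _ = _ := by ring

lemma md_binom_sum (n k : ℕ) (hn : 1 ≤ n) (p : ℝ) (hp : 0 < p) (hp1 : p ≤ 1) :
    ∑ j ∈ Finset.range (n + 1), (n.choose j : ℝ) * (p ^ j * (1 - p) ^ (n - j)
      * ((j + 1).ascFactorial k : ℝ)⁻¹) ≤ (((n : ℝ) * p) ^ k)⁻¹ := by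
  have hq : 0 ≤ 1 - p := by linarith
  have hn' : (0 : ℝ) < n := by exact_mod_cast hn
  have hA : (n : ℝ) ^ k ≤ ((n + 1).ascFactorial k : ℝ) := by
    exact_mod_cast (Nat.pow_le_pow_left (Nat.le_succ n) k).trans
      (Nat.pow_succ_le_ascFactorial (n + 1) k)
  have hApos : (0 : ℝ) < ((n + 1).ascFactorial k : ℝ) := lt_of_lt_of_le (by positivity) hA
  have key : (((n + 1).ascFactorial k : ℝ) * p ^ k) *
      ∑ j ∈ Finset.range (n + 1), (n.choose j : ℝ) * (p ^ j * (1 - p) ^ (n - j)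
      * ((j + 1).ascFactorial k : ℝ)⁻¹) ≤ 1 := by
    have h1 : (1 : ℝ) = ∑ i ∈ Finset.range (k + (n + 1)),
        p ^ i * (1 - p) ^ (n + k - i) * ((n + k).choose i : ℝ) := by
      have := add_pow p (1 - p) (n + k)
      rw [show k + (n + 1) = n + k + 1 by ring, ← this]; simp
    rw [Finset.sum_range_add] at h1
    refine le_trans ?_ h1.ge
    rw [Finset.mul_sum]
    have h2 : 0 ≤ ∑ i ∈ Finset.range k,
        p ^ i * (1 - p) ^ (n + k - i) * ((n + k).choose i : ℝ) :=
      Finset.sum_nonneg fun i _ => by positivity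
    refine le_trans (le_of_eq ?_) (le_add_of_nonneg_left h2)
    refine Finset.sum_congr rfl fun j hj => ?_
    have hj' : j ≤ n := by have := Finset.mem_range.1 hj; omega
    have h3 : (n.choose j : ℝ) * ((n + 1).ascFactorial k : ℝ)
        = ((n + k).choose (j + k) : ℝ) * ((j + 1).ascFactorial k : ℝ) := by
      exact_mod_cast md_choose_asc n j k hj'
    have h4 : ((j + 1).ascFactorial k : ℝ) ≠ 0 := by
      have := Nat.ascFactorial_pos (j + 1) k
      positivity
    rw [show n + k - (k + j) = n - j by omega, show k + j = j + k by ring]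
    calc _ = ((n.choose j : ℝ) * ((n + 1).ascFactorial k : ℝ)) * ((j + 1).ascFactorial k : ℝ)⁻¹ *
          p ^ (j + k) * (1 - p) ^ (n - j) := by ring
      _ = _ := by rw [h3]; field_simp
  rw [mul_pow]
  rw [← one_div, le_div_iff₀ (by positivity), mul_comm]
  refine le_trans ?_ key
  gcongr

lemma md_inv_le (N k : ℕ) (hk : 1 ≤ k) :
    ((N : ℝ) ^ k)⁻¹ ≤ ((k + 1).factorial : ℝ) * ((N + 1).ascFactorial k : ℝ)⁻¹ := by
  rcases Nat.eq_zero_or_pos N with rfl | hN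
  · rw [Nat.cast_zero, zero_pow (by omega), inv_zero]; positivity
  · have h := md_asc_le N hN k
    have h' : ((N + 1).ascFactorial k : ℝ) ≤ ((k + 1).factorial : ℝ) * (N : ℝ) ^ k := by
      exact_mod_cast h
    have hN' : (0 : ℝ) < N := by exact_mod_cast hN
    have h4 : (0 : ℝ) < ((N + 1).ascFactorial k : ℝ) := by
      exact_mod_cast Nat.ascFactorial_pos N k
    rw [← div_eq_mul_inv, le_div_iff₀ h4, inv_mul_le_iff₀ (by positivity), mul_comm]
    exact (h' : _ ≤ _)


lemma md_card_meas {Ω : Type*} [MeasurableSpace Ω] (n : ℕ) (S : ℕ → Set Ω)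
    (hS : ∀ i, MeasurableSet (S i)) :
    Measurable fun ω => (((Finset.range n).filter fun i => ω ∈ S i).card : ℝ) := by
  have : (fun ω => (((Finset.range n).filter fun i => ω ∈ S i).card : ℝ))
      = fun ω => ∑ i ∈ Finset.range n, (S i).indicator (fun _ => (1 : ℝ)) ω := by
    ext ω
    rw [Finset.card_filter]
    push_cast
    refine Finset.sum_congr rfl fun i _ => ?_
    simp [Set.indicator_apply]
  rw [this]
  exact Finset.measurable_sum _ fun i _ => measurable_const.indicator (hS i)

lemma md_count_integral {Ω E : Type*} [MeasurableSpace Ω] [MeasurableSpace E]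
    (P : Measure Ω) [IsProbabilityMeasure P]
    (X : ℕ → Ω → E) (hXm : ∀ i, Measurable (X i)) (hXi : iIndepFun X P)
    (A : Set E) (hA : MeasurableSet A) (p : ℝ) (hp : ∀ i, P.real (X i ⁻¹' A) = p)
    (n : ℕ) (h : ℕ → ℝ) :
    ∫ ω, h ((Finset.range n).filter fun i => X i ω ∈ A).card ∂P
      = ∑ j ∈ Finset.range (n + 1), (n.choose j : ℝ) * (p ^ j * (1 - p) ^ (n - j) * h j) := by
  let S : Finset ℕ → Set Ω := fun s => ⋂ i ∈ Finset.range n, X i ⁻¹' (if i ∈ s then A else Aᶜ)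
  have hSm : ∀ s, MeasurableSet (S s) := fun s => by
    refine Finset.measurableSet_biInter _ fun i _ => hXm i ?_
    split_ifs
    exacts [hA, hA.compl]
  have hSr : ∀ s ∈ (Finset.range n).powerset, P.real (S s) = p ^ s.card * (1 - p) ^ (n - s.card) := by
    intro s hs
    have hs' := Finset.mem_powerset.1 hs
    have h1 : P (S s) = ∏ i ∈ Finset.range n, P (X i ⁻¹' (if i ∈ s then A else Aᶜ)) :=
      hXi.meas_biInter fun i _ => ⟨_, by split_ifs; exacts [hA, hA.compl], rfl⟩
    rw [measureReal_def, h1, ENNReal.toReal_prod]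
    have h2 : ∀ i, (P (X i ⁻¹' (if i ∈ s then A else Aᶜ))).toReal = if i ∈ s then p else 1 - p := by
      intro i
      split_ifs
      · exact hp i
      · rw [Set.preimage_compl, ← measureReal_def, probReal_compl_eq_one_sub (hXm i hA), hp i]
    simp_rw [h2]
    rw [Finset.prod_ite, Finset.prod_const, Finset.prod_const]
    congr 2
    · rw [Finset.filter_mem_eq_inter, Finset.inter_eq_right.2 hs']
    · rw [Finset.filter_notMem_eq_sdiff, Finset.card_sdiff_of_subset hs', Finset.card_range]
  have hpt : ∀ ω, h ((Finset.range n).filter fun i => X i ω ∈ A).card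
      = ∑ s ∈ (Finset.range n).powerset, (S s).indicator (fun _ => h s.card) ω := by
    intro ω
    set s0 := (Finset.range n).filter fun i => X i ω ∈ A with hs0
    rw [Finset.sum_eq_single s0]
    · rw [Set.indicator_of_mem]
      simp only [S, Set.mem_iInter]
      intro i hi
      by_cases hA' : X i ω ∈ A
      · have : i ∈ s0 := by rw [hs0, Finset.mem_filter]; exact ⟨hi, hA'⟩
        simp [this, hA']
      · have : i ∉ s0 := by rw [hs0, Finset.mem_filter]; tauto
        simp [this, hA']
    · intro s hs hne
      apply Set.indicator_of_notMem
      intro hω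
      apply hne
      simp only [S, Set.mem_iInter] at hω
      ext i
      rw [hs0, Finset.mem_filter]
      have hs' := Finset.mem_powerset.1 hs
      constructor
      · intro hi
        have := hω i (hs' hi)
        simp [hi] at this
        exact ⟨hs' hi, this⟩
      · rintro ⟨hi, hiA⟩
        by_contra hc
        have := hω i hi
        simp [hc] at this
        exact this hiA
    · intro hc
      exact absurd (Finset.mem_powerset.2 (Finset.filter_subset _ _)) hc
  simp_rw [hpt]
  rw [integral_finsetSum _ fun s _ => (integrable_const _).indicator (hSm s)]
  have : ∀ s ∈ (Finset.range n).powerset, ∫ ω, (S s).indicator (fun _ => h s.card) ω ∂P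
      = p ^ s.card * (1 - p) ^ (n - s.card) * h s.card := by
    intro s hs
    rw [integral_indicator_const _ (hSm s), hSr s hs, smul_eq_mul]
  rw [Finset.sum_congr rfl this,
    Finset.sum_powerset_apply_card (fun j => p ^ j * (1 - p) ^ (n - j) * h j)]
  simp

lemma md_inv_moment {Ω E : Type*} [MeasurableSpace Ω] [MeasurableSpace E]
    (P : Measure Ω) [IsProbabilityMeasure P]
    (X : ℕ → Ω → E) (hXm : ∀ i, Measurable (X i)) (hXi : iIndepFun X P)
    (A : Set E) (hA : MeasurableSet A) (p : ℝ) (hp : ∀ i, P.real (X i ⁻¹' A) = p)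
    (hp0 : 0 < p) (n k : ℕ) (hn : 1 ≤ n) (hk : 1 ≤ k) :
    ∫ ω, ((((Finset.range n).filter fun i => X i ω ∈ A).card : ℝ) ^ k)⁻¹ ∂P
      ≤ ((k + 1).factorial : ℝ) * (((n : ℝ) * p) ^ k)⁻¹ := by
  have hp1 : p ≤ 1 := by rw [← hp 0]; exact measureReal_le_one
  rw [md_count_integral P X hXm hXi A hA p hp n (fun N => ((N : ℝ) ^ k)⁻¹)]
  refine le_trans ?_ (mul_le_mul_of_nonneg_left (md_binom_sum n k hn p hp0 hp1) (by positivity))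
  rw [Finset.mul_sum]
  refine Finset.sum_le_sum fun j _ => ?_
  have hq : 0 ≤ 1 - p := by linarith
  calc _ ≤ (n.choose j : ℝ) * (p ^ j * (1 - p) ^ (n - j) *
        (((k + 1).factorial : ℝ) * ((j + 1).ascFactorial k : ℝ)⁻¹)) := by
        gcongr
        exact md_inv_le j k hk
    _ = _ := by ring

lemma md_curry_indep {Ω ι κ : Type*} [MeasurableSpace Ω] (P : Measure Ω) [IsProbabilityMeasure P]
    (Y : ι × κ → Ω → ℝ) (hY : ∀ p, Measurable (Y p)) (hi : iIndepFun Y P) :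
    iIndepFun (fun i ω (j : κ) => Y (i, j) ω) P := by
  have : ∀ p, IsProbabilityMeasure (P.map (Y p)) := fun p =>
    Measure.isProbabilityMeasure_map (hY p).aemeasurable
  rw [iIndepFun_iff_map_fun_eq_infinitePi_map (by fun_prop)]
  have h1 : ∀ i, P.map (fun ω (j : κ) => Y (i, j) ω)
      = Measure.infinitePi fun j => P.map (Y (i, j)) := fun i =>
    (hi.precomp (g := fun j : κ => (i, j)) (fun a b h => by simpa using h)).map_fun_eq_infinitePi_map
      (fun j => hY _)
  simp_rw [h1]
  have h2 := hi.map_fun_eq_infinitePi_map hY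
  have h3 := Measure.infinitePi_map_curry (fun i j => P.map (Y (i, j)))
  rw [← h3, ← h2, Measure.map_map (by fun_prop) (by fun_prop)]
  rfl

lemma md_inv_nonneg (N k : ℕ) : 0 ≤ ((N : ℝ) ^ k)⁻¹ := by positivity

lemma md_inv_le_one (N k : ℕ) : ((N : ℝ) ^ k)⁻¹ ≤ 1 := by
  have h : (N : ℝ) ^ k = ((N ^ k : ℕ) : ℝ) := by push_cast; rfl
  rw [h]
  exact Nat.cast_inv_le_one _

lemma md_prod_le_sum {ι : Type*} [Fintype ι] [Nonempty ι] (r : ι → ℝ) (hr : ∀ b, 0 ≤ r b)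
    (kv : ι → ℕ) : ∏ b, r b ^ kv b ≤ ∑ b, r b ^ (∑ b, kv b) := by
  obtain ⟨b0, hb0⟩ := Finite.exists_max r
  calc ∏ b, r b ^ kv b ≤ ∏ b, r b0 ^ kv b :=
        Finset.prod_le_prod (fun b _ => pow_nonneg (hr b) _)
          (fun b _ => pow_le_pow_left₀ (hr b) (hb0 b) _)
    _ = r b0 ^ (∑ b, kv b) := Finset.prod_pow_eq_pow_sum _ _ _
    _ ≤ _ := Finset.single_le_sum (f := fun b => r b ^ (∑ b, kv b))
        (fun b _ => pow_nonneg (hr b) _) (Finset.mem_univ b0)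

lemma md_min_pow (u : ℝ) (hu : 0 < u) (k : ℕ) : (min 1 (1 / u)) ^ k = min 1 (1 / u ^ k) := by
  rcases le_total u 1 with h | h
  · have h1 : 1 ≤ 1 / u := by rw [le_div_iff₀ hu]; linarith
    have h2 : 1 ≤ 1 / u ^ k := by
      rw [le_div_iff₀ (by positivity), one_mul]; exact pow_le_one₀ hu.le h
    rw [min_eq_left h1, min_eq_left h2, one_pow]
  · have h1 : 1 / u ≤ 1 := by rw [div_le_iff₀ hu]; linarith
    have h2 : 1 / u ^ k ≤ 1 := by
      rw [div_le_iff₀ (by positivity), one_mul]; exact one_le_pow₀ h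
    rw [min_eq_right h1, min_eq_right h2, one_div_pow]

lemma md_fixed {Ω E : Type*} [MeasurableSpace Ω] [MeasurableSpace E]
    (P : Measure Ω) [IsProbabilityMeasure P]
    (X : ℕ → Ω → E) (hXm : ∀ i, Measurable (X i)) (hXi : iIndepFun X P)
    (B₀ : ℕ) (hB₀ : 1 ≤ B₀) (kv : Fin B₀ → ℕ) (hk : 1 ≤ ∑ b, kv b)
    (A : Fin B₀ → Set E) (hA : ∀ b, MeasurableSet (A b))
    (p : Fin B₀ → ℝ) (hp : ∀ b i, P.real (X i ⁻¹' A b) = p b)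
    (m : ℝ) (hm : 0 < m) (hm1 : m ≤ 1) (v : Fin B₀ → ℝ) (hv : ∀ b, 0 < v b)
    (hpv : ∀ b, m * v b ≤ p b) (n : ℕ) (hn : 1 ≤ n) :
    ∫ ω, ∏ b, ((((Finset.range n).filter fun i => X i ω ∈ A b).card : ℝ) ^ kv b)⁻¹ ∂P
      ≤ (B₀ * (((∑ b, kv b) + 1).factorial / m ^ (∑ b, kv b)))
        * ∏ b, min 1 (1 / ((n : ℝ) * v b) ^ kv b) := by
  have : Nonempty (Fin B₀) := ⟨⟨0, hB₀⟩⟩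
  have hn' : (0 : ℝ) < n := by exact_mod_cast hn
  set k := ∑ b, kv b with hkdef
  let N : Fin B₀ → Ω → ℕ := fun b ω => ((Finset.range n).filter fun i => X i ω ∈ A b).card
  have hNm : ∀ b, Measurable fun ω => (N b ω : ℝ) := fun b =>
    md_card_meas n (fun i => X i ⁻¹' A b) (fun i => hXm i (hA b))
  set a : Fin B₀ → ℝ := fun b => min 1 (1 / ((n : ℝ) * v b)) with ha
  have hu : ∀ b, 0 < (n : ℝ) * v b := fun b => mul_pos hn' (hv b)
  have hapos : ∀ b, 0 < a b := fun b => lt_min one_pos (one_div_pos.2 (hu b))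
  have hmk : 0 < m ^ k := by positivity
  have hfac : (1 : ℝ) ≤ ((k + 1).factorial : ℝ) := by exact_mod_cast Nat.factorial_pos _
  -- single cell moment
  have hone : ∀ b, ∫ ω, ((N b ω : ℝ) ^ k)⁻¹ ∂P ≤ ((k + 1).factorial / m ^ k) * a b ^ k := by
    intro b
    rw [ha]
    simp only
    rw [md_min_pow _ (hu b)]
    rcases le_total 1 (1 / ((n : ℝ) * v b) ^ k) with h | h
    · rw [min_eq_left h, mul_one]
      have h1 : ∫ ω, ((N b ω : ℝ) ^ k)⁻¹ ∂P ≤ 1 := by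
        have := integral_mono_of_nonneg (μ := P) (f := fun ω => ((N b ω : ℝ) ^ k)⁻¹)
          (g := fun _ => (1 : ℝ)) (ae_of_all _ fun ω => md_inv_nonneg _ _) (integrable_const _)
          (ae_of_all _ fun ω => md_inv_le_one _ _)
        simpa using this
      refine h1.trans ?_
      rw [le_div_iff₀ hmk, one_mul]
      exact (pow_le_one₀ hm.le hm1).trans hfac
    · rw [min_eq_right h]
      have hp0 : 0 < p b := lt_of_lt_of_le (mul_pos hm (hv b)) (hpv b)
      refine (md_inv_moment P X hXm hXi (A b) (hA b) (p b) (hp b) hp0 n k hn hk).trans ?_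
      rw [div_mul_div_comm, mul_one, ← mul_pow, ← div_eq_mul_inv]
      have h2 : m * ((n : ℝ) * v b) ≤ n * p b := by nlinarith [hpv b]
      have h3 := hu b
      gcongr
  have hint : ∀ b, Integrable (fun ω => ((N b ω : ℝ) ^ k)⁻¹) P := fun b =>
    Integrable.of_bound (((hNm b).pow_const k).inv.aestronglyMeasurable) 1
      (ae_of_all _ fun ω => by
        rw [Real.norm_of_nonneg (md_inv_nonneg _ _)]; exact md_inv_le_one _ _)
  have hpt : ∀ ω, ∏ b, ((N b ω : ℝ) ^ kv b)⁻¹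
      ≤ ∑ b, (∏ b, a b ^ kv b) * ((a b ^ k)⁻¹ * ((N b ω : ℝ) ^ k)⁻¹) := by
    intro ω
    have h1 := md_prod_le_sum (fun b => (a b)⁻¹ * (N b ω : ℝ)⁻¹)
      (fun b => mul_nonneg (inv_nonneg.2 (hapos b).le) (by positivity)) kv
    have h2 : ∏ b, ((N b ω : ℝ) ^ kv b)⁻¹
        = (∏ b, a b ^ kv b) * ∏ b, ((a b)⁻¹ * (N b ω : ℝ)⁻¹) ^ kv b := by
      rw [← Finset.prod_mul_distrib]
      refine Finset.prod_congr rfl fun b _ => ?_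
      rw [← mul_pow, ← mul_assoc, mul_inv_cancel₀ (hapos b).ne', one_mul, inv_pow]
    rw [h2, ← Finset.mul_sum]
    refine mul_le_mul_of_nonneg_left (h1.trans (le_of_eq ?_))
      (Finset.prod_nonneg fun b _ => pow_nonneg (hapos b).le _)
    refine Finset.sum_congr rfl fun b _ => ?_
    rw [mul_pow, inv_pow, inv_pow]
  have hPi : ∏ b, min 1 (1 / ((n : ℝ) * v b) ^ kv b) = ∏ b, a b ^ kv b :=
    Finset.prod_congr rfl fun b _ => (md_min_pow _ (hu b) _).symm
  rw [hPi]
  have hPi0 : 0 ≤ ∏ b, a b ^ kv b := Finset.prod_nonneg fun b _ => pow_nonneg (hapos b).le _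
  calc ∫ ω, ∏ b, ((N b ω : ℝ) ^ kv b)⁻¹ ∂P
      ≤ ∫ ω, ∑ b, (∏ b, a b ^ kv b) * ((a b ^ k)⁻¹ * ((N b ω : ℝ) ^ k)⁻¹) ∂P := by
        refine integral_mono_of_nonneg
          (ae_of_all _ fun ω => Finset.prod_nonneg fun b _ => md_inv_nonneg _ _) ?_
          (ae_of_all _ hpt)
        exact integrable_finsetSum _ fun b _ => ((hint b).const_mul _).const_mul _
    _ = ∑ b, (∏ b, a b ^ kv b) * ((a b ^ k)⁻¹ * ∫ ω, ((N b ω : ℝ) ^ k)⁻¹ ∂P) := by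
        rw [integral_finsetSum _ fun b _ => ((hint b).const_mul _).const_mul _]
        refine Finset.sum_congr rfl fun b _ => ?_
        rw [integral_const_mul, integral_const_mul]
    _ ≤ ∑ b : Fin B₀, (∏ b, a b ^ kv b) * ((k + 1).factorial / m ^ k) := by
        refine Finset.sum_le_sum fun b _ => mul_le_mul_of_nonneg_left ?_ hPi0
        rw [inv_mul_le_iff₀ (pow_pos (hapos b) _), mul_comm]
        exact hone b
    _ = _ := by
        rw [Finset.sum_const, Finset.card_univ, Fintype.card_fin, nsmul_eq_mul]; ring

lemma md_const (B₀ k : ℕ) (hk : 1 ≤ k) (hB : B₀ ≤ k) (m : ℝ) (hm : 0 < m) (hm1 : m ≤ 1) :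
    (B₀ : ℝ) * ((k + 1).factorial / m ^ k) ≤ (36 * (k : ℝ) / m) ^ ((2:ℕ) ^ B₀ * k) := by
  have hk' : (1 : ℝ) ≤ k := by exact_mod_cast hk
  have h1 : (1 : ℝ) ≤ 36 * k / m := by rw [le_div_iff₀ hm]; linarith
  have h2 : (36 * (k : ℝ) / m) ^ k ≤ (36 * (k : ℝ) / m) ^ ((2:ℕ) ^ B₀ * k) :=
    pow_le_pow_right₀ h1 (Nat.le_mul_of_pos_left _ (by positivity))
  refine le_trans ?_ h2
  have h3 : B₀ * (k + 1).factorial ≤ (36 * k) ^ k := by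
    have ha : B₀ ≤ 18 ^ k := hB.trans (Nat.lt_pow_self (by norm_num)).le
    have hb : (k + 1).factorial ≤ (2 * k) ^ k := by
      have := Nat.ascFactorial_le_pow_add 1 k
      have h4 := Nat.factorial_mul_ascFactorial 1 k
      simp only [Nat.factorial_one, one_mul] at h4
      rw [add_comm k 1, ← h4]
      exact this.trans (Nat.pow_le_pow_left (by omega) _)
    calc _ ≤ 18 ^ k * (2 * k) ^ k := Nat.mul_le_mul ha hb
      _ = _ := by rw [← mul_pow]; ring_nf
  rw [div_pow, ← mul_div_assoc]
  gcongr
  exact_mod_cast h3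

lemma md_cell_eq {d : ℕ} (x : Fin d → ℝ) (lam : ℝ) (lo hi : Fin d → ℝ) :
    {z | inMondrianCell x lam lo hi z}
      = Set.Icc (fun j => x j - min (lo j / lam) (x j))
          (fun j => x j + min (hi j / lam) (1 - x j)) := by
  ext z
  simp only [inMondrianCell, Set.mem_ofPred_eq, Set.mem_Icc, Pi.le_def]
  exact forall_and

lemma md_box_eq (d : ℕ) : unitBox d = Set.Icc (fun _ => 0) (fun _ => 1) := by
  rw [unitBox, Set.pi_univ_Icc]

lemma md_prob_lower {Ω : Type*} [MeasurableSpace Ω] (P : Measure Ω) [IsProbabilityMeasure P]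
    (d : ℕ) (f : (Fin d → ℝ) → ℝ) (m : ℝ) (hm : 0 < m) (hmf : ∀ z ∈ unitBox d, m ≤ f z)
    (X : Ω → Fin d → ℝ) (hXm : Measurable X)
    (hXd : Measure.map X P = volume.withDensity fun z => ENNReal.ofReal (f z))
    (a b : Fin d → ℝ) (hab : a ≤ b) (ha : ∀ j, 0 ≤ a j) (hb : ∀ j, b j ≤ 1) :
    m * ∏ j, (b j - a j) ≤ P.real (X ⁻¹' Set.Icc a b) := by
  have h1 : P (X ⁻¹' Set.Icc a b) = ∫⁻ z in Set.Icc a b, ENNReal.ofReal (f z) := by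
    rw [← Measure.map_apply hXm measurableSet_Icc, hXd, withDensity_apply _ measurableSet_Icc]
  have h2 : ENNReal.ofReal m * volume (Set.Icc a b) ≤ P (X ⁻¹' Set.Icc a b) := by
    rw [h1, ← setLIntegral_const]
    refine setLIntegral_mono' measurableSet_Icc fun z hz => ENNReal.ofReal_le_ofReal (hmf z ?_)
    rw [md_box_eq]
    exact ⟨fun j => (ha j).trans (hz.1 j), fun j => (hz.2 j).trans (hb j)⟩
  have h3 := ENNReal.toReal_mono (measure_ne_top P _) h2
  rw [ENNReal.toReal_mul, ENNReal.toReal_ofReal hm.le, Real.volume_Icc_pi_toReal hab] at h3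
  exact h3

/-- one factor of the right-hand side as a function of the exponentials of one cell -/
def mdh {d : ℕ} (x : Fin d → ℝ) (l : ℝ) (n k : ℕ) (u : Fin d × Bool → ℝ) : ℝ :=
  min 1 (1 / ((n : ℝ) * mondrianVol x l (fun j => u (j, false)) (fun j => u (j, true))) ^ k)

lemma mdh_meas {d : ℕ} (x : Fin d → ℝ) (l : ℝ) (n k : ℕ) : Measurable (mdh x l n k) := by
  unfold mdh
  simp only [mondrianVol, mondrianSide]
  fun_prop

lemma mdH_meas {d B : ℕ} (x : Fin d → ℝ) (l : ℝ) (n : ℕ) (kv : Fin B → ℕ) :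
    Measurable fun t : Fin B × Fin d × Bool → ℝ => ∏ b, mdh x l n (kv b) (fun p => t (b, p)) := by
  have h1 : ∀ b : Fin B, Measurable fun t : Fin B × Fin d × Bool → ℝ =>
      mdh x l n (kv b) (fun p => t (b, p)) := by
    intro b
    have h2 : Measurable fun (t : Fin B × Fin d × Bool → ℝ) (p : Fin d × Bool) => t (b, p) :=
      measurable_pi_lambda _ fun p => measurable_pi_apply (b, p)
    exact (mdh_meas x l n (kv b)).comp h2
  exact Finset.measurable_fun_prod _ fun b _ => h1 b

lemma mdS_meas {d B : ℕ} (x : Fin d → ℝ) (l : ℝ) (b : Fin B) (i : ℕ) :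
    MeasurableSet {q : (Fin B × Fin d × Bool → ℝ) × (ℕ → Fin d → ℝ) |
      inMondrianCell x l (fun j => q.1 (b, j, false)) (fun j => q.1 (b, j, true)) (q.2 i)} := by
  simp only [inMondrianCell]
  rw [Set.ofPred_forall]
  refine MeasurableSet.iInter fun j => ?_
  have h1 : Measurable fun q : (Fin B × Fin d × Bool → ℝ) × (ℕ → Fin d → ℝ) =>
    x j - min (q.1 (b, j, false) / l) (x j) := by fun_prop
  have h2 : Measurable fun q : (Fin B × Fin d × Bool → ℝ) × (ℕ → Fin d → ℝ) =>
    x j + min (q.1 (b, j, true) / l) (1 - x j) := by fun_prop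
  have h3 : Measurable fun q : (Fin B × Fin d × Bool → ℝ) × (ℕ → Fin d → ℝ) => q.2 i j := by
    fun_prop
  exact (measurableSet_le h1 h3).inter (measurableSet_le h3 h2)

set_option maxHeartbeats 1000000 in
/-- Lemma 5: generalized moment bound for Mondrian random forest
denominators. For `B₀` independent Mondrian cells at `x` with lifetime `λ_n` and i.i.d.
data with density `f`, independent of the cells, for all large `n`,
`E[∏_b 1{N_b(x) ≥ 1}/N_b(x)^{k_b}]
  ≤ (36k/inf f)^{2^{B₀} k} ∏_b E[min(1, 1/(n|T_b(x)|)^{k_b})]`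
(here `1{N ≥ 1}/N^k` is written as `(N^k)⁻¹` using the real-division convention `1/0 = 0`). -/
theorem mondrian_denominator_moment_bound
    {Ω : Type*} [MeasurableSpace Ω] (P : Measure Ω) [IsProbabilityMeasure P]
    (d B₀ : ℕ) (hd : 1 ≤ d) (hB₀ : 1 ≤ B₀)
    (kv : Fin B₀ → ℕ) (hkv : ∀ b, 1 ≤ kv b)
    (x : Fin d → ℝ) (hx : ∀ j, x j ∈ Set.Ioo (0:ℝ) 1)
    (f : (Fin d → ℝ) → ℝ)
    (hf_int : (∫ z, f z) = 1)
    (hf_pos : ∃ c > (0:ℝ), ∀ z ∈ unitBox d, c ≤ f z)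
    (hf_bdd : ∃ M : ℝ, ∀ z, f z ≤ M)
    (hf_supp : ∀ z, z ∉ unitBox d → f z = 0)
    (lam : ℕ → ℝ) (hlam_pos : ∀ n, 0 < lam n)
    (hlam1 : Tendsto (fun n : ℕ => lam n ^ d / n) atTop (𝓝 0))
    (hlam2 : ∃ c₁ > (0:ℝ), ∃ c₂ > (0:ℝ), ∀ᶠ n : ℕ in atTop,
      c₁ * Real.log n ≤ Real.log (lam n) ∧ Real.log (lam n) ≤ c₂ * Real.log n)
    (Elo Ehi : ℕ → Fin B₀ → Ω → Fin d → ℝ)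
    (hexp : ∀ n b j, IsExpOne P (fun ω => Elo n b ω j) ∧ IsExpOne P (fun ω => Ehi n b ω j))
    (hindepE : ∀ n, iIndepFun
      (fun p : Fin B₀ × Fin d × Bool => fun ω =>
        if p.2.2 then Ehi n p.1 ω p.2.1 else Elo n p.1 ω p.2.1) P)
    (X : ℕ → Ω → Fin d → ℝ) (hXm : ∀ i, Measurable (X i))
    (hXd : ∀ i, Measure.map (X i) P = volume.withDensity fun z => ENNReal.ofReal (f z))
    (hXiid : iIndepFun X P)
    (hindepXT : ∀ n, IndepFun
      (fun ω => fun p : Fin B₀ × Fin d × Bool =>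
        if p.2.2 then Ehi n p.1 ω p.2.1 else Elo n p.1 ω p.2.1)
      (fun ω => fun i : ℕ => X i ω) P) :
    ∀ᶠ n : ℕ in atTop,
      (∫ ω, ∏ b, ((((Finset.range n).filter fun i =>
            inMondrianCell x (lam n) (Elo n b ω) (Ehi n b ω) (X i ω)).card : ℝ) ^ kv b)⁻¹ ∂P)
        ≤ (36 * (∑ b, kv b : ℕ) / sInf (f '' unitBox d)) ^ ((2:ℕ) ^ B₀ * ∑ b, kv b)
          * ∏ b, ∫ ω, min 1
              (1 / ((n : ℝ) * mondrianVol x (lam n) (Elo n b ω) (Ehi n b ω)) ^ kv b) ∂P := by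
  obtain ⟨c, hc, hcf⟩ := hf_pos
  set m := sInf (f '' unitBox d) with hmdef
  have hbne : (f '' unitBox d).Nonempty :=
    ⟨_, x, by rw [md_box_eq]; exact ⟨fun j => (hx j).1.le, fun j => (hx j).2.le⟩, rfl⟩
  have hbb : BddBelow (f '' unitBox d) := ⟨c, by rintro _ ⟨z, hz, rfl⟩; exact hcf z hz⟩
  have hm : 0 < m := lt_of_lt_of_le hc (le_csInf hbne (by rintro _ ⟨z, hz, rfl⟩; exact hcf z hz))
  have hmf : ∀ z ∈ unitBox d, m ≤ f z := fun z hz => csInf_le hbb ⟨z, hz, rfl⟩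
  have hm1 : m ≤ 1 := by
    have := md_prob_lower P d f m hm hmf (X 0) (hXm 0) (hXd 0) (fun _ => 0) (fun _ => 1)
      (fun _ => zero_le_one) (fun _ => le_rfl) (fun _ => le_rfl)
    simp only [sub_zero, Finset.prod_const_one, mul_one] at this
    exact this.trans measureReal_le_one
  have hBk : B₀ ≤ ∑ b, kv b := by
    have := Finset.sum_le_sum (s := Finset.univ) fun b _ => hkv b
    simpa using this
  have hk1 : 1 ≤ ∑ b, kv b := hB₀.trans hBk
  filter_upwards [eventually_ge_atTop 1] with n hn
  have hl := hlam_pos n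
  set l := lam n with hldef
  -- the randomness
  let Y : Fin B₀ × Fin d × Bool → Ω → ℝ := fun p ω =>
    if p.2.2 then Ehi n p.1 ω p.2.1 else Elo n p.1 ω p.2.1
  have hYm : ∀ p, Measurable (Y p) := by
    rintro ⟨b, j, s⟩
    cases s
    · exact (hexp n b j).1.1
    · exact (hexp n b j).2.1
  have hYpos : ∀ᵐ ω ∂P, ∀ p, 0 < Y p ω := by
    rw [ae_all_iff]
    rintro ⟨b, j, s⟩
    have hpos : ∀ E : Ω → ℝ, IsExpOne P E → ∀ᵐ ω ∂P, 0 < E ω := by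
      intro E hE
      have h1 := hE.2 0 le_rfl
      rw [neg_zero, Real.exp_zero, ENNReal.ofReal_one] at h1
      exact (prob_compl_eq_zero_iff (measurableSet_lt measurable_const hE.1)).2 h1
    cases s
    · exact hpos _ (hexp n b j).1
    · exact hpos _ (hexp n b j).2
  let τ : Ω → (Fin B₀ × Fin d × Bool → ℝ) := fun ω p => Y p ω
  let ξ : Ω → (ℕ → Fin d → ℝ) := fun ω i => X i ω
  have hτm : Measurable τ := measurable_pi_lambda _ hYm
  have hξm : Measurable ξ := measurable_pi_lambda _ hXm
  have hjoint : P.map (fun ω => (τ ω, ξ ω)) = (P.map τ).prod (P.map ξ) :=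
    (indepFun_iff_map_prod_eq_prod_map_map hτm.aemeasurable hξm.aemeasurable).1 (hindepXT n)
  have : IsProbabilityMeasure (P.map τ) := Measure.isProbabilityMeasure_map hτm.aemeasurable
  have : IsProbabilityMeasure (P.map ξ) := Measure.isProbabilityMeasure_map hξm.aemeasurable
  let lo : (Fin B₀ × Fin d × Bool → ℝ) → Fin B₀ → Fin d → ℝ := fun t b j => t (b, j, false)
  let hi : (Fin B₀ × Fin d × Bool → ℝ) → Fin B₀ → Fin d → ℝ := fun t b j => t (b, j, true)
  let S : Fin B₀ → ℕ → Set ((Fin B₀ × Fin d × Bool → ℝ) × (ℕ → Fin d → ℝ)) := fun b i =>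
    {q | inMondrianCell x l (lo q.1 b) (hi q.1 b) (q.2 i)}
  have hSm : ∀ b i, MeasurableSet (S b i) := fun b i => mdS_meas x l b i
  let G : (Fin B₀ × Fin d × Bool → ℝ) × (ℕ → Fin d → ℝ) → ℝ := fun q =>
    ∏ b, ((((Finset.range n).filter fun i => q ∈ S b i).card : ℝ) ^ kv b)⁻¹
  have hGm : Measurable G :=
    Finset.measurable_fun_prod _ fun b _ => ((md_card_meas n (S b) (hSm b)).pow_const _).inv
  have hG0 : ∀ q, 0 ≤ G q := fun q => Finset.prod_nonneg fun b _ => md_inv_nonneg _ _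
  have hG1 : ∀ q, G q ≤ 1 := fun q =>
    Finset.prod_le_one (fun b _ => md_inv_nonneg _ _) fun b _ => md_inv_le_one _ _
  have hGi : Integrable G ((P.map τ).prod (P.map ξ)) :=
    Integrable.of_bound hGm.aestronglyMeasurable 1
      (ae_of_all _ fun q => by rw [Real.norm_of_nonneg (hG0 q)]; exact hG1 q)
  -- the bound
  let h : Fin B₀ → (Fin d × Bool → ℝ) → ℝ := fun b => mdh x l n (kv b)
  have hhm : ∀ b, Measurable (h b) := fun b => mdh_meas x l n (kv b)
  let H : (Fin B₀ × Fin d × Bool → ℝ) → ℝ := fun t => ∏ b, h b (fun p => t (b, p))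
  have hHm : Measurable H := mdH_meas x l n kv
  have hh1 : ∀ b u, h b u ≤ 1 := fun b u => min_le_left _ _
  set C : ℝ := (B₀ * (((∑ b, kv b) + 1).factorial / m ^ (∑ b, kv b))) with hC
  have hC0 : 0 ≤ C := by positivity
  have hinner : ∀ t : Fin B₀ × Fin d × Bool → ℝ, (∀ p, 0 < t p) →
      0 ≤ H t ∧ H t ≤ 1 ∧ ∫ y, G (t, y) ∂(P.map ξ) ≤ C * H t := by
    intro t ht
    have hside : ∀ b j, 0 < mondrianSide x l (lo t b) (hi t b) j := fun b j =>
      add_pos (lt_min (div_pos (ht _) hl) (hx j).1)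
        (lt_min (div_pos (ht _) hl) (by linarith [(hx j).2]))
    have hvol : ∀ b, 0 < mondrianVol x l (lo t b) (hi t b) := fun b =>
      Finset.prod_pos fun j _ => hside b j
    have hn' : (0 : ℝ) < n := by exact_mod_cast hn
    have hh0 : ∀ b, 0 ≤ h b (fun p => t (b, p)) := fun b =>
      le_min zero_le_one (one_div_nonneg.2 (pow_nonneg (mul_nonneg hn'.le (hvol b).le) _))
    refine ⟨Finset.prod_nonneg fun b _ => hh0 b,
      Finset.prod_le_one (fun b _ => hh0 b) fun b _ => hh1 b _, ?_⟩
    have hGt : Measurable fun y => G (t, y) := hGm.comp measurable_prodMk_left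
    rw [integral_map hξm.aemeasurable hGt.aestronglyMeasurable]
    have hAm : ∀ b, MeasurableSet {z | inMondrianCell x l (lo t b) (hi t b) z} := fun b => by
      rw [md_cell_eq]; exact measurableSet_Icc
    refine md_fixed P X hXm hXiid B₀ hB₀ kv hk1
      (fun b => {z | inMondrianCell x l (lo t b) (hi t b) z}) hAm
      (fun b => P.real (X 0 ⁻¹' {z | inMondrianCell x l (lo t b) (hi t b) z}))
      (fun b i => ?_) m hm hm1 (fun b => mondrianVol x l (lo t b) (hi t b)) hvol (fun b => ?_) n hn
    · rw [measureReal_def, measureReal_def, ← Measure.map_apply (hXm i) (hAm b),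
        ← Measure.map_apply (hXm 0) (hAm b), hXd i, hXd 0]
    · rw [md_cell_eq]
      have hlo : ∀ j, 0 ≤ min (lo t b j / l) (x j) := fun j =>
        le_min (div_pos (ht _) hl).le (hx j).1.le
      have hhi : ∀ j, 0 ≤ min (hi t b j / l) (1 - x j) := fun j =>
        le_min (div_pos (ht _) hl).le (by linarith [(hx j).2])
      have := md_prob_lower P d f m hm hmf (X 0) (hXm 0) (hXd 0)
        (fun j => x j - min (lo t b j / l) (x j)) (fun j => x j + min (hi t b j / l) (1 - x j))
        (fun j => by show _ ≤ _; linarith [hlo j, hhi j])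
        (fun j => by linarith [min_le_right (lo t b j / l) (x j)])
        (fun j => by linarith [min_le_right (hi t b j / l) (1 - x j)])
      refine le_trans (le_of_eq ?_) this
      rw [mondrianVol]
      congr 1
      refine Finset.prod_congr rfl fun j _ => ?_
      rw [mondrianSide]
      ring
  have hposτ : ∀ᵐ t ∂(P.map τ), ∀ p, 0 < t p := by
    rw [ae_map_iff hτm.aemeasurable]
    · exact hYpos
    · rw [Set.ofPred_forall]
      exact MeasurableSet.iInter fun p => measurableSet_lt measurable_const (by fun_prop)
  have hHi : Integrable H (P.map τ) :=
    Integrable.of_bound hHm.aestronglyMeasurable 1 (by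
      filter_upwards [hposτ] with t ht
      rw [Real.norm_of_nonneg (hinner t ht).1]
      exact (hinner t ht).2.1)
  have hblock : iIndepFun (fun b ω (p : Fin d × Bool) => Y (b, p) ω) P :=
    md_curry_indep P Y hYm (hindepE n)
  have hprod : ∫ t, H t ∂(P.map τ) = ∏ b, ∫ ω, h b (fun p => Y (b, p) ω) ∂P := by
    rw [integral_map hτm.aemeasurable hHm.aestronglyMeasurable]
    exact hblock.integral_fun_prod_comp
      (fun b => (measurable_pi_lambda _ fun p => hYm _).aemeasurable)
      (fun b => (hhm b).aestronglyMeasurable)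
  have hprod0 : 0 ≤ ∫ t, H t ∂(P.map τ) := integral_nonneg_of_ae (by
    filter_upwards [hposτ] with t ht using (hinner t ht).1)
  have hconst := md_const B₀ (∑ b, kv b) hk1 hBk m hm hm1
  calc _ = ∫ ω, G (τ ω, ξ ω) ∂P := rfl
    _ = ∫ q, G q ∂((P.map τ).prod (P.map ξ)) := by
        rw [← hjoint, integral_map (hτm.prodMk hξm).aemeasurable hGm.aestronglyMeasurable]
    _ = ∫ t, ∫ y, G (t, y) ∂(P.map ξ) ∂(P.map τ) := integral_prod _ hGi
    _ ≤ ∫ t, C * H t ∂(P.map τ) := by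
        refine integral_mono_ae hGi.integral_prod_left (hHi.const_mul C) ?_
        filter_upwards [hposτ] with t ht using (hinner t ht).2.2
    _ = C * ∫ t, H t ∂(P.map τ) := integral_const_mul _ _
    _ ≤ (36 * ((∑ b, kv b : ℕ) : ℝ) / m) ^ ((2:ℕ) ^ B₀ * ∑ b, kv b) * ∫ t, H t ∂(P.map τ) :=
        mul_le_mul_of_nonneg_right hconst hprod0
    _ = _ := by rw [hprod]; rfl
end
end

section
/- Let E_1, E_2, E_1′, E_2′ be i.i.d. Exponential(1) random variables. Then E[ ((E_1 ∧ E_1′) + (E_2 ∧ E_2′)) / ((E_1 + E_2)(E_1′ + E_2′)) ] = (4 − 4 log 2)/3. -/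
open MeasureTheory ProbabilityTheory Filter
open scoped ENNReal NNReal Topology

noncomputable section

def dens (b : ℝ) : ℝ≥0∞ := if 0 ≤ b then ENNReal.ofReal (Real.exp (-b)) else 0

lemma measurable_dens : Measurable dens := by
  unfold dens
  exact Measurable.ite measurableSet_Ici (by fun_prop) measurable_const

lemma law_eq {Ω : Type*} [MeasurableSpace Ω] (P : Measure Ω) [IsProbabilityMeasure P]
    (E : Ω → ℝ) (h : IsExpOne P E) : P.map E = volume.withDensity dens := by
  have h0 : IsProbabilityMeasure (P.map E) := Measure.isProbabilityMeasure_map h.1.aemeasurable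
  have h1 : IsProbabilityMeasure (expMeasure 1) := isProbabilityMeasure_expMeasure one_pos
  have h2 : P.map E = expMeasure 1 := by
    apply Measure.eq_of_cdf
    have hnn : ∀ x : ℝ, 0 ≤ x → cdf (P.map E) x = 1 - Real.exp (-x) := by
      intro x hx
      rw [cdf_eq_real, Measure.real, Measure.map_apply h.1 measurableSet_Iic]
      have : E ⁻¹' Set.Iic x = {ω | x < E ω}ᶜ := by ext ω; simp
      rw [this, prob_compl_eq_one_sub (measurableSet_lt measurable_const h.1), h.2 x hx,
        ENNReal.toReal_sub_of_le _ ENNReal.one_ne_top]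
      · simp [ENNReal.toReal_ofReal (Real.exp_pos _).le]
      · simpa using hx
    ext x
    rw [cdf_expMeasure_eq one_pos]
    split_ifs with hx
    · simpa using hnn x hx
    · have := monotone_cdf (P.map E) (not_le.1 hx).le
      rw [hnn 0 le_rfl] at this
      simp at this
      exact le_antisymm this (cdf_nonneg _ _)
  rw [h2, expMeasure, gammaMeasure]
  congr 1
  ext x
  have := exponentialPDF_eq 1 x
  simp only [exponentialPDF, exponentialPDFReal] at this
  rw [gammaPDF, this, dens]
  split_ifs <;> simp

lemma lint_exp (c k : ℝ) (hk : 0 < k) :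
    ∫⁻ s in Set.Ioi c, ENNReal.ofReal (Real.exp (-k * s))
      = ENNReal.ofReal (Real.exp (-k * c) / k) := by
  rw [← ofReal_integral_eq_lintegral_ofReal (integrableOn_exp_mul_Ioi (by linarith) c)
    (ae_of_all _ fun x => (Real.exp_pos _).le), integral_exp_mul_Ioi (by linarith)]
  congr 1
  field_simp

def kap (x : ℝ) (p : ℝ × ℝ) : ℝ≥0∞ := if x < p.1 then ENNReal.ofReal (1 / (p.1 + p.2)) else 0

lemma measurable_kap : Measurable (fun q : ℝ × ℝ × ℝ => kap q.1 q.2) := by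
  unfold kap
  refine Measurable.ite (measurableSet_lt (by fun_prop) (by fun_prop)) ?_ measurable_const
  exact ENNReal.measurable_ofReal.comp (by fun_prop)

lemma measurable_kap' (x : ℝ) : Measurable (kap x) :=
  measurable_kap.comp (measurable_const.prodMk measurable_id)

def GG (x : ℝ) : ℝ≥0∞ := ∫⁻ u in Set.Ioo (0:ℝ) 1, ENNReal.ofReal (Real.exp (-x / u))

lemma kap_int (x : ℝ) (hx : 0 < x) :
    ∫⁻ p, kap x p ∂((volume.withDensity dens).prod (volume.withDensity dens)) = GG x := by
  have hm := measurable_kap' x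
  rw [lintegral_prod _ hm.aemeasurable]
  have e1 : ∀ a, ∫⁻ b, kap x (a, b) ∂(volume.withDensity dens)
      = ∫⁻ b, dens b * kap x (a, b) := fun a =>
    lintegral_withDensity_eq_lintegral_mul _ measurable_dens (hm.comp measurable_prodMk_left)
  simp_rw [e1]
  have hm2 : Measurable fun a => ∫⁻ b, dens b * kap x (a, b) := by
    apply Measurable.lintegral_prod_right'
      (f := fun p : ℝ × ℝ => dens p.2 * kap x (p.1, p.2))
    exact (measurable_dens.comp measurable_snd).mul hm
  rw [lintegral_withDensity_eq_lintegral_mul _ measurable_dens hm2]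
  simp only [Pi.mul_apply]
  have e2 : ∀ a, dens a * ∫⁻ b, dens b * kap x (a, b)
      = ∫⁻ s, if x < a ∧ a ≤ s then ENNReal.ofReal (Real.exp (-s) / s) else 0 := by
    intro a
    have hma : Measurable fun b => dens b * kap x (a, b) :=
      measurable_dens.mul (hm.comp measurable_prodMk_left)
    rw [← lintegral_const_mul _ hma,
      ← lintegral_add_left_eq_self
        (fun s => if x < a ∧ a ≤ s then ENNReal.ofReal (Real.exp (-s) / s) else 0) a]
    congr 1
    ext b
    by_cases hxa : x < a
    · by_cases hb : 0 ≤ b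
      · have ha : 0 ≤ a := (hx.trans hxa).le
        simp only [dens, kap, ha, hb, hxa, if_true, true_and, le_add_iff_nonneg_right]
        rw [← ENNReal.ofReal_mul (by positivity), ← ENNReal.ofReal_mul (by positivity)]
        congr 1
        rw [neg_add, Real.exp_add]
        ring
      · simp [dens, hb]
    · simp [kap, hxa]
  simp_rw [e2]
  rw [lintegral_lintegral_swap]
  swap
  · refine Measurable.aemeasurable ?_
    have hS : MeasurableSet {a : ℝ × ℝ | x < a.1 ∧ a.1 ≤ a.2} :=
      (measurableSet_lt measurable_const measurable_fst).inter
        (measurableSet_le measurable_fst measurable_snd)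
    refine Measurable.ite hS ?_ measurable_const
    exact ENNReal.measurable_ofReal.comp (by fun_prop)
  have e3 : ∀ s, (∫⁻ a, if x < a ∧ a ≤ s then ENNReal.ofReal (Real.exp (-s) / s) else 0)
      = ∫⁻ u in Set.Ioo (0:ℝ) 1, if x / u < s then ENNReal.ofReal (Real.exp (-s)) else 0 := by
    intro s
    have l : (∫⁻ a, if x < a ∧ a ≤ s then ENNReal.ofReal (Real.exp (-s) / s) else 0)
        = ENNReal.ofReal (Real.exp (-s) / s) * ENNReal.ofReal (s - x) := by
      rw [← Real.volume_Ioc, ← lintegral_indicator_const measurableSet_Ioc]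
      congr 1
      ext a
      simp [Set.indicator]
    rw [l]
    by_cases hs : x < s
    · have hs0 : 0 < s := hx.trans hs
      have r : (∫⁻ u in Set.Ioo (0:ℝ) 1,
          if x / u < s then ENNReal.ofReal (Real.exp (-s)) else 0)
          = ENNReal.ofReal (Real.exp (-s)) * ENNReal.ofReal (1 - x / s) := by
        rw [← Real.volume_Ioo, ← lintegral_indicator_const measurableSet_Ioo,
          ← lintegral_indicator measurableSet_Ioo]
        congr 1
        ext u
        have hxs : 0 < x / s := by positivity
        by_cases hu : 0 < u
        · have : x / u < s ↔ x / s < u := by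
            rw [div_lt_iff₀ hu, div_lt_iff₀ hs0, mul_comm]
          simp only [Set.indicator, Set.mem_Ioo, this, hu, true_and]
          split_ifs <;> grind
        · have : ¬ (x / s < u) := by linarith
          simp [Set.indicator, hu, this]
      rw [r, ← ENNReal.ofReal_mul (by positivity), ← ENNReal.ofReal_mul (by positivity)]
      congr 1
      field_simp
    · rw [ENNReal.ofReal_of_nonpos (by linarith : s - x ≤ 0), mul_zero]
      symm
      rw [setLIntegral_congr_fun (g := fun _ => 0) measurableSet_Ioo]
      · simp
      · intro u hu
        have : ¬ (x / u < s) := by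
          rw [div_lt_iff₀ hu.1]
          push Not at hs ⊢
          by_cases h0 : 0 ≤ s
          · nlinarith [hu.2]
          · nlinarith [hu.1]
        simp [this]
  simp_rw [e3]
  rw [lintegral_lintegral_swap]
  swap
  · refine Measurable.aemeasurable ?_
    refine Measurable.ite (measurableSet_lt (by fun_prop) (by fun_prop)) ?_ measurable_const
    exact ENNReal.measurable_ofReal.comp (by fun_prop)
  unfold GG
  congr 1
  ext u
  have := lint_exp (x / u) 1 one_pos
  rw [← lintegral_indicator measurableSet_Ioi] at this
  simp only [neg_mul, one_mul, div_one] at this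
  rw [neg_div, ← this]
  rfl

lemma inner_int (v : ℝ) (hv : 0 < v) :
    ∫⁻ u in Set.Ioo (0:ℝ) 1, ENNReal.ofReal (u * v / (u + v))
      = ENNReal.ofReal (v - v ^ 2 * Real.log (1 + v) + v * (v * Real.log v)) := by
  have hc : ContinuousOn (fun u : ℝ => u * v / (u + v)) (Set.Icc 0 1) := by
    refine ContinuousOn.div (by fun_prop) (by fun_prop) fun u hu => ?_
    linarith [hu.1]
  rw [← ofReal_integral_eq_lintegral_ofReal
    ((hc.integrableOn_Icc).mono_set Set.Ioo_subset_Icc_self)]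
  · rw [← integral_Ioc_eq_integral_Ioo, ← intervalIntegral.integral_of_le zero_le_one,
      intervalIntegral.integral_eq_sub_of_hasDerivAt
        (f := fun u => v * u - v ^ 2 * Real.log (u + v))]
    · congr 1
      simp
      ring
    · intro u hu
      rw [Set.uIcc_of_le zero_le_one] at hu
      have h0 : u + v ≠ 0 := by linarith [hu.1]
      refine HasDerivAt.congr_deriv (((hasDerivAt_id u).const_mul v).sub
        ((((hasDerivAt_id u).add_const v).log h0).const_mul (v ^ 2))) ?_
      rw [id]
      field_simp
      ring
    · apply ContinuousOn.intervalIntegrable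
      rwa [Set.uIcc_of_le zero_le_one]
  · filter_upwards [ae_restrict_mem measurableSet_Ioo] with u hu
    have := hu.1
    simp only [Pi.zero_apply]
    positivity

lemma outer_int : ∫⁻ v in Set.Ioo (0:ℝ) 1,
      ENNReal.ofReal (v - v ^ 2 * Real.log (1 + v) + v * (v * Real.log v))
      = ENNReal.ofReal ((2 - 2 * Real.log 2) / 3) := by
  have hl : ContinuousOn (fun v : ℝ => Real.log (1 + v)) (Set.Icc 0 1) := by
    refine ContinuousOn.log (by fun_prop) fun u hu => ?_
    linarith [hu.1]
  have hml := Real.continuous_mul_log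
  have hc : ContinuousOn
      (fun v : ℝ => v - v ^ 2 * Real.log (1 + v) + v * (v * Real.log v)) (Set.Icc 0 1) := by
    have := hml.continuousOn (s := Set.Icc (0:ℝ) 1)
    fun_prop
  rw [← ofReal_integral_eq_lintegral_ofReal
    ((hc.integrableOn_Icc).mono_set Set.Ioo_subset_Icc_self)]
  · rw [← integral_Ioc_eq_integral_Ioo, ← intervalIntegral.integral_of_le zero_le_one,
      intervalIntegral.integral_eq_sub_of_hasDerivAt_of_le zero_le_one
        (f := fun v => v ^ 2 / 2 - v ^ 3 / 3 * Real.log (1 + v)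
          + (v ^ 3 / 3 - v ^ 2 / 2 + v - Real.log (1 + v)) / 3
          + v ^ 2 / 3 * (v * Real.log v) - v ^ 3 / 9)]
    · congr 1
      norm_num
      ring
    · have := hml.continuousOn (s := Set.Icc (0:ℝ) 1)
      fun_prop
    · intro v hv
      have h0 : v ≠ 0 := hv.1.ne'
      have h1 : 1 + v ≠ 0 := by linarith [hv.1]
      have d1 := ((hasDerivAt_id v).const_add 1).log h1
      have d2 := Real.hasDerivAt_log h0
      have p2 := hasDerivAt_pow 2 v
      have p3 := hasDerivAt_pow 3 v
      have p1 := hasDerivAt_id v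
      have := ((((p2.div_const 2).sub ((p3.div_const 3).mul d1)).add
        (((((p3.div_const 3).sub (p2.div_const 2)).add p1).sub d1).div_const 3)).add
        ((p2.div_const 3).mul (p1.mul d2))).sub (p3.div_const 9)
      refine HasDerivAt.congr_deriv this ?_
      simp only [Pi.mul_apply, id]
      norm_num
      field_simp
      ring
    · apply ContinuousOn.intervalIntegrable
      rwa [Set.uIcc_of_le zero_le_one]
  · filter_upwards [ae_restrict_mem measurableSet_Ioo] with v hv
    have hv0 := hv.1
    simp only [Pi.zero_apply]
    have h1 : Real.log (1 + 1 / v) ≤ 1 / v := by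
      have := Real.log_le_sub_one_of_pos (show 0 < 1 + 1 / v by positivity)
      linarith
    have h2 : Real.log (1 + 1 / v) = Real.log (1 + v) - Real.log v := by
      rw [← Real.log_div (by positivity) (by positivity)]
      congr 1
      field_simp
      ring
    rw [h2] at h1
    have h3 := mul_le_mul_of_nonneg_left h1 (sq_nonneg v)
    have h4 : v ^ 2 * (1 / v) = v := by field_simp
    rw [h4] at h3
    nlinarith

lemma GG_int : ∫⁻ x in Set.Ioi (0:ℝ), GG x * GG x
    = ENNReal.ofReal ((2 - 2 * Real.log 2) / 3) := by
  have hm : ∀ x : ℝ, Measurable fun u : ℝ => ENNReal.ofReal (Real.exp (-x / u)) := fun x =>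
    ENNReal.measurable_ofReal.comp (by fun_prop)
  have hm3 : Measurable fun q : (ℝ × ℝ) × ℝ =>
      ENNReal.ofReal (Real.exp (-q.1.1 / q.2)) * ENNReal.ofReal (Real.exp (-q.1.1 / q.1.2)) :=
    (ENNReal.measurable_ofReal.comp (by fun_prop)).mul
      (ENNReal.measurable_ofReal.comp (by fun_prop))
  have e : ∀ x, GG x * GG x = ∫⁻ v in Set.Ioo (0:ℝ) 1, ∫⁻ u in Set.Ioo (0:ℝ) 1,
      ENNReal.ofReal (Real.exp (-x / u)) * ENNReal.ofReal (Real.exp (-x / v)) := by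
    intro x
    conv_rhs =>
      enter [2, v]
      rw [lintegral_mul_const _ (hm x)]
    rw [lintegral_const_mul _ (hm x)]
    rfl
  simp_rw [e]
  rw [lintegral_lintegral_swap]
  swap
  · exact (Measurable.lintegral_prod_right' hm3).aemeasurable
  rw [← outer_int]
  refine setLIntegral_congr_fun measurableSet_Ioo fun v hv => ?_
  rw [lintegral_lintegral_swap]
  swap
  · refine Measurable.aemeasurable ?_
    exact hm3.comp (f := fun p : ℝ × ℝ => ((p.1, v), p.2)) (by fun_prop)
  rw [← inner_int v hv.1]
  refine setLIntegral_congr_fun measurableSet_Ioo fun u hu => ?_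
  have hu0 := hu.1
  have hv0 := hv.1
  have := lint_exp 0 (1 / u + 1 / v) (by positivity)
  rw [show u * v / (u + v) = Real.exp (-(1 / u + 1 / v) * 0) / (1 / u + 1 / v) by
    simp; field_simp; ring, ← this]
  congr 1
  ext x
  rw [← ENNReal.ofReal_mul (by positivity), ← Real.exp_add]
  congr 2
  ring

lemma ae_pos {Ω : Type*} [MeasurableSpace Ω] (P : Measure Ω) [IsProbabilityMeasure P]
    (E : Ω → ℝ) (h : IsExpOne P E) : ∀ᵐ ω ∂P, 0 < E ω := by
  have h1 : P {ω | 0 < E ω} = 1 := by simpa using h.2 0 le_rfl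
  exact (mem_ae_iff_prob_eq_one (measurableSet_lt measurable_const h.1)).2 h1

lemma half {Ω : Type*} [MeasurableSpace Ω] (P : Measure Ω) [IsProbabilityMeasure P]
    (E : Fin 4 → Ω → ℝ) (hexp : ∀ i, IsExpOne P (E i))
    (hindep : iIndepFun E P) (i j k l : Fin 4) (hij : i ≠ j) (hkl : k ≠ l)
    (hik : i ≠ k) (hil : i ≠ l) (hjk : j ≠ k) (hjl : j ≠ l) :
    ∫⁻ ω, ENNReal.ofReal (min (E i ω) (E k ω) / ((E i ω + E j ω) * (E k ω + E l ω))) ∂P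
      = ENNReal.ofReal ((2 - 2 * Real.log 2) / 3) := by
  have hE : ∀ i, Measurable (E i) := fun i => (hexp i).1
  have hk : ∀ i j, i ≠ j → ∀ x, 0 < x → ∫⁻ ω, kap x (E i ω, E j ω) ∂P = GG x := by
    intro i j hij x hx
    rw [← kap_int x hx]
    have h2 := (indepFun_iff_map_prod_eq_prod_map_map (hE i).aemeasurable
      (hE j).aemeasurable).1 (hindep.indepFun hij)
    rw [law_eq P _ (hexp i), law_eq P _ (hexp j)] at h2
    rw [← h2, lintegral_map (measurable_kap' x) ((hE i).prodMk (hE j))]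
  have hI := hindep.indepFun_prodMk_prodMk hE i j k l hik hil hjk hjl
  have step : ∀ᵐ ω ∂P,
      ENNReal.ofReal (min (E i ω) (E k ω) / ((E i ω + E j ω) * (E k ω + E l ω)))
      = ∫⁻ x in Set.Ioi (0:ℝ), kap x (E i ω, E j ω) * kap x (E k ω, E l ω) := by
    filter_upwards [ae_pos P _ (hexp i), ae_pos P _ (hexp j), ae_pos P _ (hexp k),
      ae_pos P _ (hexp l)] with ω h1 h2 h3 h4
    rw [div_eq_mul_inv, mul_comm, ENNReal.ofReal_mul (by positivity),
      ← sub_zero (min (E i ω) (E k ω)), ← Real.volume_Ioo,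
      ← lintegral_indicator_const measurableSet_Ioo, ← lintegral_indicator measurableSet_Ioi]
    congr 1
    ext x
    simp only [Set.indicator, Set.mem_Ioo, Set.mem_Ioi, kap, lt_min_iff]
    by_cases a0 : 0 < x <;> by_cases a1 : x < E i ω <;> by_cases a2 : x < E k ω <;>
      simp only [a0, a1, a2, if_true, if_false, and_true, and_false, true_and, false_and,
        mul_zero, zero_mul]
    rw [← ENNReal.ofReal_mul (by positivity)]
    congr 1
    field_simp
  rw [lintegral_congr_ae step, lintegral_lintegral_swap]
  swap
  · refine Measurable.aemeasurable ?_
    exact (measurable_kap.comp (f := fun p : Ω × ℝ => (p.2, E i p.1, E j p.1))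
      (by fun_prop)).mul
      (measurable_kap.comp (f := fun p : Ω × ℝ => (p.2, E k p.1, E l p.1)) (by fun_prop))
  rw [← GG_int]
  refine setLIntegral_congr_fun measurableSet_Ioi fun x hx => ?_
  rw [lintegral_mul_eq_lintegral_mul_lintegral_of_indepFun'', hk i j hij x hx, hk k l hkl x hx]
  · exact ((measurable_kap' x).comp ((hE i).prodMk (hE j))).aemeasurable
  · exact ((measurable_kap' x).comp ((hE k).prodMk (hE l))).aemeasurable
  · exact hI.comp (measurable_kap' x) (measurable_kap' x)

/-- for i.i.d. Exponential(1) random variables `E₁, E₂, E₁', E₂'`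
(taken here as `E 0, E 1, E 2, E 3`),
`E[((E₁ ∧ E₁') + (E₂ ∧ E₂')) / ((E₁ + E₂)(E₁' + E₂'))] = (4 − 4 log 2)/3`. -/
theorem exp_min_ratio_integral
    {Ω : Type*} [MeasurableSpace Ω] (P : Measure Ω) [IsProbabilityMeasure P]
    (E : Fin 4 → Ω → ℝ) (hexp : ∀ i, IsExpOne P (E i))
    (hindep : iIndepFun E P) :
    ∫ ω, (min (E 0 ω) (E 2 ω) + min (E 1 ω) (E 3 ω))
        / ((E 0 ω + E 1 ω) * (E 2 ω + E 3 ω)) ∂P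
      = (4 - 4 * Real.log 2) / 3 := by
  have hE : ∀ i, Measurable (E i) := fun i => (hexp i).1
  have hE0 := hE 0
  have hE1 := hE 1
  have hE2 := hE 2
  have hE3 := hE 3
  have hpos : ∀ᵐ ω ∂P, ∀ i, 0 < E i ω := ae_all_iff.2 fun i => ae_pos P _ (hexp i)
  have A := half P E hexp hindep 0 1 2 3 (by decide) (by decide) (by decide) (by decide)
    (by decide) (by decide)
  have B := half P E hexp hindep 1 0 3 2 (by decide) (by decide) (by decide) (by decide)
    (by decide) (by decide)
  rw [integral_eq_lintegral_of_nonneg_ae]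
  · have hl : 0 ≤ (2 - 2 * Real.log 2) / 3 := by
      have := Real.log_two_lt_d9
      linarith
    have : ∫⁻ ω, ENNReal.ofReal ((min (E 0 ω) (E 2 ω) + min (E 1 ω) (E 3 ω))
        / ((E 0 ω + E 1 ω) * (E 2 ω + E 3 ω))) ∂P
        = ∫⁻ ω, (ENNReal.ofReal (min (E 0 ω) (E 2 ω) / ((E 0 ω + E 1 ω) * (E 2 ω + E 3 ω)))
          + ENNReal.ofReal (min (E 1 ω) (E 3 ω) / ((E 1 ω + E 0 ω) * (E 3 ω + E 2 ω)))) ∂P := by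
      refine lintegral_congr_ae ?_
      filter_upwards [hpos] with ω h
      have h0 := h 0
      have h1 := h 1
      have h2 := h 2
      have h3 := h 3
      rw [← ENNReal.ofReal_add (by positivity) (by positivity), add_comm (E 1 ω) (E 0 ω),
        add_comm (E 3 ω) (E 2 ω), add_div]
    have hmm : Measurable fun ω =>
        ENNReal.ofReal (min (E 0 ω) (E 2 ω) / ((E 0 ω + E 1 ω) * (E 2 ω + E 3 ω))) :=
      ENNReal.measurable_ofReal.comp (by fun_prop)
    rw [this, lintegral_add_left hmm, A, B,
      ← ENNReal.ofReal_add hl hl, ENNReal.toReal_ofReal (by linarith)]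
    ring
  · filter_upwards [hpos] with ω h
    have h0 := h 0
    have h1 := h 1
    have h2 := h 2
    have h3 := h 3
    simp only [Pi.zero_apply]
    positivity
  · exact Measurable.aestronglyMeasurable (by fun_prop)
end
end

section
/- Let a, b > 0 and let E_1, E_2, E_3, E_4 be i.i.d. Exponential(1) random variables. Then E[ ((E_1/a ∧ E_3/b) + (E_2/a ∧ E_4/b)) / ((E_1 + E_2)(E_3 + E_4)) ] = (2/(3a)) (1 − (b/a) log(a/b + 1)) + (2/(3b)) (1 − (a/b) log(b/a + 1)). -/
open MeasureTheory ProbabilityTheory Filter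
open scoped ENNReal NNReal Topology

noncomputable section

section aux
open Set Real

lemma aux_lint_exp {c : ℝ} (hc : 0 < c) (s : ℝ) :
    ∫⁻ x in Ioi s, ENNReal.ofReal (Real.exp (-(c * x))) = ENNReal.ofReal (Real.exp (-(c * s)) / c) := by
  have h1 := integrableOn_exp_mul_Ioi (neg_lt_zero.2 hc) s
  have h2 := integral_exp_mul_Ioi (neg_lt_zero.2 hc) s
  rw [neg_div_neg_eq] at h2
  simp only [neg_mul] at h1 h2
  rw [← h2, ofReal_integral_eq_lintegral_ofReal h1]
  exact ae_of_all _ fun x => (Real.exp_pos _).le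

lemma aux_lint_Ioi {g g' : ℝ → ℝ} {l : ℝ} (hd : ∀ x ∈ Ici (1:ℝ), HasDerivAt g (g' x) x)
    (hp : ∀ x ∈ Ioi (1:ℝ), 0 ≤ g' x) (hl : Tendsto g atTop (𝓝 l)) :
    ∫⁻ x in Ioi (1:ℝ), ENNReal.ofReal (g' x) = ENNReal.ofReal (l - g 1) ∧ 0 ≤ l - g 1 := by
  have h1 := integrableOn_Ioi_deriv_of_nonneg' hd hp hl
  have h2 := integral_Ioi_of_hasDerivAt_of_nonneg' hd hp hl
  rw [← h2]
  have h3 : 0 ≤ᵐ[volume.restrict (Ioi (1:ℝ))] g' := by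
    filter_upwards [ae_restrict_mem measurableSet_Ioi] with x hx using hp x hx
  exact ⟨(ofReal_integral_eq_lintegral_ofReal h1 h3).symm, integral_nonneg_of_ae h3⟩

lemma aux_tendsto_log {a b : ℝ} (ha : 0 < a) (hb : 0 < b) :
    Tendsto (fun u : ℝ => Real.log (a * u + b) - Real.log u) atTop (𝓝 (Real.log a)) := by
  have h : Tendsto (fun u : ℝ => Real.log (a + b * u⁻¹)) atTop (𝓝 (Real.log a)) := by
    have h0 : Tendsto (fun u : ℝ => a + b * u⁻¹) atTop (𝓝 a) := by
      simpa using (tendsto_inv_atTop_zero.const_mul b).const_add a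
    exact h0.log ha.ne'
  refine h.congr' ?_
  filter_upwards [eventually_gt_atTop 0] with u hu
  rw [← Real.log_div (by positivity) hu.ne']
  congr 1
  field_simp

lemma aux_tendsto_log_div {a b : ℝ} (ha : 0 < a) (hb : 0 < b) :
    Tendsto (fun u : ℝ => (Real.log (a * u + b) - Real.log b) / u ^ 3) atTop (𝓝 0) := by
  have h1 := aux_tendsto_log ha hb
  have h2 : Tendsto (fun u : ℝ => Real.log u * u⁻¹) atTop (𝓝 0) := by
    simpa [div_eq_mul_inv] using Real.tendsto_pow_log_div_mul_add_atTop 1 0 1 one_ne_zero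
  have hi : Tendsto (fun u : ℝ => u⁻¹) atTop (𝓝 0) := tendsto_inv_atTop_zero
  have h3 := ((h1.sub_const (Real.log b)).mul (hi.pow 3)).add (h2.mul (hi.pow 2))
  simp only [ne_eq, OfNat.ofNat_ne_zero, not_false_eq_true, zero_pow, mul_zero, add_zero] at h3
  refine h3.congr' ?_
  filter_upwards [eventually_gt_atTop 0] with u hu
  field_simp
  ring

lemma aux_inner {c b : ℝ} (hc : 0 < c) (hb : 0 < b) :
    ∫⁻ v in Ioi (1:ℝ), ENNReal.ofReal (1 / (v ^ 2 * (c + b * v)))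
      = ENNReal.ofReal (1 / c - b / c ^ 2 * (Real.log (c + b) - Real.log b)) ∧
    0 ≤ 1 / c - b / c ^ 2 * (Real.log (c + b) - Real.log b) := by
  have hd : ∀ v ∈ Ici (1:ℝ), HasDerivAt
      (fun v : ℝ => -(1 / c) * v⁻¹ + b / c ^ 2 * (Real.log (b * v + c) - Real.log v))
      (1 / (v ^ 2 * (c + b * v))) v := by
    intro v hv
    have hv0 : 0 < v := lt_of_lt_of_le one_pos hv
    have e1 := (hasDerivAt_inv hv0.ne').const_mul (-(1 / c))
    have e2 : HasDerivAt (fun v : ℝ => b * v + c) b v := by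
      simpa using ((hasDerivAt_id v).const_mul b).add_const c
    have hne : b * v + c ≠ 0 := by positivity
    have e3 := (((e2.log hne).sub (Real.hasDerivAt_log hv0.ne')).const_mul (b / c ^ 2))
    refine (e1.add e3).congr_deriv ?_
    have : c + b * v ≠ 0 := by positivity
    field_simp
    ring
  have ht := ((tendsto_inv_atTop_zero (𝕜 := ℝ)).const_mul (-(1 / c))).add
    ((aux_tendsto_log hb hc).const_mul (b / c ^ 2))
  have := aux_lint_Ioi hd (fun v hv => by
    have hv0 : 0 < v := lt_trans one_pos hv
    positivity) ht
  have e : -(1 / c) * 0 + b / c ^ 2 * Real.log b -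
      (-(1 / c) * (1:ℝ)⁻¹ + b / c ^ 2 * (Real.log (b * 1 + c) - Real.log 1))
      = 1 / c - b / c ^ 2 * (Real.log (c + b) - Real.log b) := by
    rw [mul_one, add_comm b c]; simp; ring
  rwa [e] at this

def auxJ (a b : ℝ) : ℝ := (1 / (3 * a)) * (1 - (b / a) * Real.log (a / b + 1))
        + (1 / (3 * b)) * (1 - (a / b) * Real.log (b / a + 1))

lemma aux_outer {a b : ℝ} (ha : 0 < a) (hb : 0 < b) :
    ∫⁻ u in Ioi (1:ℝ), ENNReal.ofReal
      (1 / u ^ 2 * (1 / (a * u) - b / (a * u) ^ 2 * (Real.log (a * u + b) - Real.log b)))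
      = ENNReal.ofReal (auxJ a b) ∧ 0 ≤ auxJ a b := by
  have hd : ∀ u ∈ Ici (1:ℝ), HasDerivAt
      (fun u : ℝ => -(1 / (2 * a)) * u⁻¹ ^ 2 + b / (3 * a ^ 2) *
        ((Real.log (a * u + b) - Real.log b) / u ^ 3) + 1 / (6 * a) * u⁻¹ ^ 2
        - 1 / (3 * b) * u⁻¹ + a / (3 * b ^ 2) * (Real.log (a * u + b) - Real.log u))
      (1 / u ^ 2 * (1 / (a * u) - b / (a * u) ^ 2 * (Real.log (a * u + b) - Real.log b))) u := by
    intro u hu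
    have hu0 : 0 < u := lt_of_lt_of_le one_pos hu
    have e1 := hasDerivAt_inv hu0.ne'
    have e2 : HasDerivAt (fun u : ℝ => a * u + b) a u := by
      simpa using ((hasDerivAt_id u).const_mul a).add_const b
    have hne : a * u + b ≠ 0 := by positivity
    have e3 := e2.log hne
    have e4 := (e3.sub_const (Real.log b)).div (hasDerivAt_pow 3 u) (by positivity)
    have e5 := (((((e1.pow 2).const_mul (-(1 / (2 * a)))).add (e4.const_mul (b / (3 * a ^ 2)))).add
      ((e1.pow 2).const_mul (1 / (6 * a)))).sub (e1.const_mul (1 / (3 * b)))).add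
      ((e3.sub (Real.hasDerivAt_log hu0.ne')).const_mul (a / (3 * b ^ 2)))
    refine e5.congr_deriv ?_
    generalize Real.log (a * u + b) - Real.log b = L
    simp
    field_simp
    ring
  have hi : Tendsto (fun u : ℝ => u⁻¹) atTop (𝓝 0) := tendsto_inv_atTop_zero
  have ht := (((((hi.pow 2).const_mul (-(1 / (2 * a)))).add
    ((aux_tendsto_log_div ha hb).const_mul (b / (3 * a ^ 2)))).add
      ((hi.pow 2).const_mul (1 / (6 * a)))).sub (hi.const_mul (1 / (3 * b)))).add
      ((aux_tendsto_log ha hb).const_mul (a / (3 * b ^ 2)))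
  have := aux_lint_Ioi hd (fun u hu => by
    have hu0 : 0 < u := lt_trans one_pos hu
    have := (aux_inner (c := a * u) (by positivity) hb).2
    positivity) ht
  have l1 : Real.log (a / b + 1) = Real.log (a + b) - Real.log b := by
    rw [← Real.log_div (by positivity) hb.ne']; congr 1; field_simp
  have l2 : Real.log (b / a + 1) = Real.log (a + b) - Real.log a := by
    rw [← Real.log_div (by positivity) ha.ne']; congr 1; field_simp; ring
  convert! this using 2
  · congr 1
    simp only [auxJ, l1, l2, mul_one, Real.log_one]
    field_simp
    ring
  · simp only [auxJ, l1, l2, mul_one, Real.log_one]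
    field_simp
    ring

lemma aux_double {a b : ℝ} (ha : 0 < a) (hb : 0 < b) :
    ∫⁻ u in Ioi (1:ℝ), ∫⁻ v in Ioi (1:ℝ),
      ENNReal.ofReal (1 / (u ^ 2 * v ^ 2 * (a * u + b * v))) = ENNReal.ofReal (auxJ a b) := by
  rw [← (aux_outer ha hb).1]
  refine setLIntegral_congr_fun measurableSet_Ioi fun u hu => ?_
  have hu0 : 0 < u := lt_trans one_pos hu
  have h := (aux_inner (c := a * u) (by positivity) hb).1
  rw [ENNReal.ofReal_mul (by positivity), ← h, ← lintegral_const_mul _ (by fun_prop)]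
  refine lintegral_congr fun v => ?_
  rw [← ENNReal.ofReal_mul (by positivity)]
  congr 1
  rw [div_mul_div_comm]; ring_nf

variable {Ω : Type*} [MeasurableSpace Ω] {P : Measure Ω} [IsProbabilityMeasure P]

lemma aux_pos {X : Ω → ℝ} (hX : IsExpOne P X) : ∀ᵐ ω ∂P, 0 < X ω := by
  have h := hX.2 0 le_rfl
  simp only [neg_zero, Real.exp_zero, ENNReal.ofReal_one] at h
  exact (prob_compl_eq_zero_iff (measurableSet_lt measurable_const hX.1)).2 h

lemma aux_map {X : Ω → ℝ} (hX : IsExpOne P X) : P.map X = expMeasure 1 := by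
  have : IsProbabilityMeasure (expMeasure 1) := isProbabilityMeasure_expMeasure one_pos
  have : IsProbabilityMeasure (P.map X) := Measure.isProbabilityMeasure_map hX.1.aemeasurable
  apply Measure.eq_of_cdf
  ext x
  rw [cdf_expMeasure_eq one_pos, cdf_eq_real, map_measureReal_apply hX.1 measurableSet_Iic]
  have key : ∀ t : ℝ, 0 ≤ t → P.real (X ⁻¹' Iic t) = 1 - Real.exp (-t) := by
    intro t ht
    have h1 : (X ⁻¹' Iic t) = {ω | t < X ω}ᶜ := by ext; simp
    rw [h1, probReal_compl_eq_one_sub (measurableSet_lt measurable_const hX.1), measureReal_def,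
      hX.2 t ht, ENNReal.toReal_ofReal (Real.exp_pos _).le]
  split_ifs with h
  · rw [key x h, one_mul]
  · have h0 := key 0 le_rfl
    simp only [neg_zero, Real.exp_zero, sub_self] at h0
    refine le_antisymm (h0 ▸ measureReal_mono ?_) measureReal_nonneg
    intro ω hω
    simp only [mem_preimage, mem_Iic] at *
    linarith

/-- indicator of `t < x` -/
def auxg (t x : ℝ) : ℝ≥0∞ := if t < x then 1 else 0

lemma measurable_auxg {α : Type*} [MeasurableSpace α] {f h : α → ℝ} (hf : Measurable f)
    (hh : Measurable h) : Measurable (fun x => auxg (f x) (h x)) :=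
  Measurable.ite (measurableSet_lt hf hh) measurable_const measurable_const

lemma aux_single {X : Ω → ℝ} (hX : IsExpOne P X) {u s : ℝ} (hu : 0 < u) (hs : 0 ≤ s) :
    ∫⁻ ω, auxg s (X ω) * ENNReal.ofReal (Real.exp (-((u - 1) * X ω))) ∂P
      = ENNReal.ofReal (Real.exp (-(u * s)) / u) := by
  have hm : Measurable (fun x : ℝ => auxg s x * ENNReal.ofReal (Real.exp (-((u - 1) * x)))) :=
    (measurable_auxg measurable_const measurable_id).mul (by fun_prop)
  rw [← lintegral_map (f := fun x : ℝ => auxg s x * ENNReal.ofReal (Real.exp (-((u - 1) * x))))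
    hm hX.1, aux_map hX, ← aux_lint_exp hu s]
  have hpm : Measurable (gammaPDF 1 1) := (measurable_gammaPDFReal 1 1).ennreal_ofReal
  rw [expMeasure, gammaMeasure, lintegral_withDensity_eq_lintegral_mul _ hpm hm,
    ← lintegral_indicator measurableSet_Ioi]
  refine lintegral_congr fun x => ?_
  have hpdf : gammaPDF 1 1 x = exponentialPDF 1 x := rfl
  by_cases h : s < x
  · have hx : 0 ≤ x := hs.trans h.le
    simp only [Pi.mul_apply, auxg, h, if_true, one_mul, hpdf, exponentialPDF_of_nonneg hx,
      indicator, mem_Ioi]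
    rw [← ENNReal.ofReal_mul (Real.exp_pos _).le, ← Real.exp_add]
    ring_nf
  · simp [auxg, h]

lemma aux_phi {X Y : Ω → ℝ} (hX : IsExpOne P X) (hY : IsExpOne P Y) (hXY : IndepFun X Y P)
    {s : ℝ} (hs : 0 ≤ s) :
    ∫⁻ ω, auxg s (X ω) * ENNReal.ofReal (X ω + Y ω)⁻¹ ∂P
      = ∫⁻ u in Ioi (1:ℝ), ENNReal.ofReal (Real.exp (-(u * s)) / u ^ 2) := by
  have hXm := hX.1
  have hYm := hY.1
  have e1 : ∫⁻ ω, auxg s (X ω) * ENNReal.ofReal (X ω + Y ω)⁻¹ ∂P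
      = ∫⁻ ω, (∫⁻ u in Ioi (1:ℝ), (auxg s (X ω) * ENNReal.ofReal (Real.exp (-((u - 1) * X ω)))) *
        (auxg 0 (Y ω) * ENNReal.ofReal (Real.exp (-((u - 1) * Y ω))))) ∂P := by
    refine lintegral_congr_ae ?_
    filter_upwards [aux_pos hX, aux_pos hY] with ω hx hy
    have hxy : 0 < X ω + Y ω := add_pos hx hy
    have h1 := aux_lint_exp hxy 1
    have h2 : ENNReal.ofReal (X ω + Y ω)⁻¹ = ∫⁻ u in Ioi (1:ℝ),
        ENNReal.ofReal (Real.exp (-((u - 1) * X ω))) *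
          ENNReal.ofReal (Real.exp (-((u - 1) * Y ω))) := by
      have h3 : (X ω + Y ω)⁻¹ = Real.exp (X ω + Y ω) *
          (Real.exp (-((X ω + Y ω) * 1)) / (X ω + Y ω)) := by
        rw [mul_one, Real.exp_neg]
        field_simp
      rw [h3, ENNReal.ofReal_mul (Real.exp_pos _).le, ← h1, ← lintegral_const_mul _ (by fun_prop)]
      refine lintegral_congr fun u => ?_
      rw [← ENNReal.ofReal_mul (Real.exp_pos _).le, ← ENNReal.ofReal_mul (Real.exp_pos _).le,
        ← Real.exp_add, ← Real.exp_add]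
      ring_nf
    rw [h2, ← lintegral_const_mul _ (by fun_prop)]
    refine lintegral_congr fun u => ?_
    simp only [auxg, hy, if_true]
    ring
  have mX : Measurable (fun p : Ω × ℝ => X p.1) := hXm.comp measurable_fst
  have mY : Measurable (fun p : Ω × ℝ => Y p.1) := hYm.comp measurable_fst
  rw [e1, lintegral_lintegral_swap]
  · refine setLIntegral_congr_fun measurableSet_Ioi fun u hu => ?_
    have hu0 : 0 < u := lt_trans one_pos hu
    have m : ∀ t : ℝ, Measurable (fun x : ℝ => auxg t x * ENNReal.ofReal (Real.exp (-((u - 1) * x)))) :=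
      fun t => (measurable_auxg measurable_const measurable_id).mul (by fun_prop)
    have := lintegral_mul_eq_lintegral_mul_lintegral_of_indepFun''
      (((m s).comp hXm).aemeasurable (μ := P)) (((m 0).comp hYm).aemeasurable (μ := P))
      (hXY.comp (m s) (m 0))
    simp only [Function.comp_apply] at this
    rw [this, aux_single hX hu0 hs, aux_single hY hu0 le_rfl, ← ENNReal.ofReal_mul (by positivity)]
    congr 1
    simp
    field_simp
  · refine Measurable.aemeasurable ?_
    refine ((measurable_auxg measurable_const mX).mul ?_).mul
      ((measurable_auxg measurable_const mY).mul ?_) <;> fun_prop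

lemma aux_min {a b x z : ℝ} (ha : 0 < a) (hb : 0 < b) :
    ENNReal.ofReal (min (x / a) (z / b)) = ∫⁻ t in Ioi (0:ℝ), auxg (a * t) x * auxg (b * t) z := by
  have : ∀ t : ℝ, auxg (a * t) x * auxg (b * t) z
      = (Iio (min (x / a) (z / b))).indicator (fun _ => 1) t := by
    intro t
    have h1 : a * t < x ↔ t < x / a := by rw [lt_div_iff₀ ha, mul_comm]
    have h2 : b * t < z ↔ t < z / b := by rw [lt_div_iff₀ hb, mul_comm]
    simp only [auxg, h1, h2, indicator, mem_Iio, lt_min_iff]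
    by_cases k1 : t < x / a <;> by_cases k2 : t < z / b <;> simp [k1, k2]
  simp only [this]
  rw [lintegral_indicator measurableSet_Iio]
  simp [Measure.restrict_apply, Iio_inter_Ioi]

lemma aux_tint {a b : ℝ} (ha : 0 < a) (hb : 0 < b) :
    ∫⁻ t in Ioi (0:ℝ), (∫⁻ u in Ioi (1:ℝ), ENNReal.ofReal (Real.exp (-(u * (a * t))) / u ^ 2)) *
      (∫⁻ v in Ioi (1:ℝ), ENNReal.ofReal (Real.exp (-(v * (b * t))) / v ^ 2))
      = ENNReal.ofReal (auxJ a b) := by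
  have e1 : ∀ t : ℝ, (∫⁻ u in Ioi (1:ℝ), ENNReal.ofReal (Real.exp (-(u * (a * t))) / u ^ 2)) *
      (∫⁻ v in Ioi (1:ℝ), ENNReal.ofReal (Real.exp (-(v * (b * t))) / v ^ 2)) =
      ∫⁻ p, ENNReal.ofReal (1 / (p.1 ^ 2 * p.2 ^ 2)) *
        ENNReal.ofReal (Real.exp (-((a * p.1 + b * p.2) * t)))
        ∂((volume.restrict (Ioi (1:ℝ))).prod (volume.restrict (Ioi (1:ℝ)))) := by
    intro t
    rw [← lintegral_prod_mul (by fun_prop) (by fun_prop)]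
    refine lintegral_congr fun p => ?_
    rw [← ENNReal.ofReal_mul (by positivity), ← ENNReal.ofReal_mul (by positivity)]
    congr 1
    rw [div_mul_div_comm, ← Real.exp_add, one_div_mul_eq_div]
    ring_nf
  simp only [e1]
  rw [lintegral_lintegral_swap (by fun_prop), lintegral_prod _ (by fun_prop), ← aux_double ha hb]
  refine setLIntegral_congr_fun measurableSet_Ioi fun u hu => ?_
  refine setLIntegral_congr_fun measurableSet_Ioi fun v hv => ?_
  have hu0 : 0 < u := lt_trans one_pos hu
  have hv0 : 0 < v := lt_trans one_pos hv
  have hc : 0 < a * u + b * v := by positivity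
  rw [lintegral_const_mul _ (by fun_prop), aux_lint_exp hc, ← ENNReal.ofReal_mul (by positivity)]
  congr 1
  simp
  ring

lemma aux_core {a b : ℝ} (ha : 0 < a) (hb : 0 < b) {E : Fin 4 → Ω → ℝ}
    (hexp : ∀ i, IsExpOne P (E i)) (hindep : iIndepFun E P) (i j k l : Fin 4)
    (hij : i ≠ j) (hkl : k ≠ l) (hik : i ≠ k) (hil : i ≠ l) (hjk : j ≠ k) (hjl : j ≠ l) :
    ∫⁻ ω, ENNReal.ofReal (min (E i ω / a) (E k ω / b) / ((E i ω + E j ω) * (E k ω + E l ω))) ∂P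
      = ENNReal.ofReal (auxJ a b) := by
  have hm : ∀ i, Measurable (E i) := fun i => (hexp i).1
  have m1 : ∀ i, Measurable (fun p : Ω × ℝ => E i p.1) := fun i => (hm i).comp measurable_fst
  rw [← aux_tint ha hb]
  have e1 : ∫⁻ ω, ENNReal.ofReal
        (min (E i ω / a) (E k ω / b) / ((E i ω + E j ω) * (E k ω + E l ω))) ∂P
      = ∫⁻ ω, (∫⁻ t in Ioi (0:ℝ), (auxg (a * t) (E i ω) * ENNReal.ofReal (E i ω + E j ω)⁻¹) *
        (auxg (b * t) (E k ω) * ENNReal.ofReal (E k ω + E l ω)⁻¹)) ∂P := by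
    refine lintegral_congr_ae ?_
    filter_upwards [aux_pos (hexp i), aux_pos (hexp j), aux_pos (hexp k), aux_pos (hexp l)]
      with ω h1 h2 h3 h4
    have hg : Measurable fun t : ℝ => auxg (a * t) (E i ω) * auxg (b * t) (E k ω) :=
      (measurable_auxg (by fun_prop) measurable_const).mul
        (measurable_auxg (by fun_prop) measurable_const)
    rw [div_eq_mul_inv, mul_inv, ENNReal.ofReal_mul (by positivity),
      ENNReal.ofReal_mul (by positivity), aux_min ha hb, ← lintegral_mul_const _ hg]
    refine lintegral_congr fun t => ?_
    ring
  rw [e1, lintegral_lintegral_swap]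
  · refine setLIntegral_congr_fun measurableSet_Ioi fun t ht => ?_
    have ht0 : 0 < t := ht
    have m : ∀ s : ℝ, Measurable (fun p : ℝ × ℝ => auxg s p.1 * ENNReal.ofReal (p.1 + p.2)⁻¹) :=
      fun s => (measurable_auxg measurable_const measurable_fst).mul (by fun_prop)
    have := lintegral_mul_eq_lintegral_mul_lintegral_of_indepFun''
      (((m (a * t)).comp ((hm i).prodMk (hm j))).aemeasurable (μ := P))
      (((m (b * t)).comp ((hm k).prodMk (hm l))).aemeasurable (μ := P))
      ((hindep.indepFun_prodMk_prodMk hm i j k l hik hil hjk hjl).comp (m (a * t)) (m (b * t)))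
    simp only [Function.comp_apply] at this
    rw [this, aux_phi (hexp i) (hexp j) (hindep.indepFun hij) (by positivity),
      aux_phi (hexp k) (hexp l) (hindep.indepFun hkl) (by positivity)]
  · refine Measurable.aemeasurable ?_
    refine ((measurable_auxg (by fun_prop) (m1 i)).mul ?_).mul
      ((measurable_auxg (by fun_prop) (m1 k)).mul ?_) <;> fun_prop

end aux

/-- for `a, b > 0` and i.i.d. Exponential(1) random variables
`E₁, E₂, E₃, E₄` (taken here as `E 0, E 1, E 2, E 3`),
`E[((E₁/a ∧ E₃/b) + (E₂/a ∧ E₄/b)) / ((E₁ + E₂)(E₃ + E₄))]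
  = (2/(3a))(1 − (b/a)log(a/b + 1)) + (2/(3b))(1 − (a/b)log(b/a + 1))`. -/
theorem exp_min_ratio_integral_scaled
    {Ω : Type*} [MeasurableSpace Ω] (P : Measure Ω) [IsProbabilityMeasure P]
    (a b : ℝ) (ha : 0 < a) (hb : 0 < b)
    (E : Fin 4 → Ω → ℝ) (hexp : ∀ i, IsExpOne P (E i))
    (hindep : iIndepFun E P) :
    ∫ ω, (min (E 0 ω / a) (E 2 ω / b) + min (E 1 ω / a) (E 3 ω / b))
        / ((E 0 ω + E 1 ω) * (E 2 ω + E 3 ω)) ∂P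
      = (2 / (3 * a)) * (1 - (b / a) * Real.log (a / b + 1))
        + (2 / (3 * b)) * (1 - (a / b) * Real.log (b / a + 1)) := by
  have hm : ∀ i, Measurable (E i) := fun i => (hexp i).1
  have hm0 := hm 0
  have hm1 := hm 1
  have hm2 := hm 2
  have hm3 := hm 3
  have hJ : 0 ≤ auxJ a b := (aux_outer ha hb).2
  have h1 := aux_core ha hb hexp hindep 0 1 2 3 (by decide) (by decide) (by decide) (by decide)
    (by decide) (by decide)
  have h2 := aux_core ha hb hexp hindep 1 0 3 2 (by decide) (by decide) (by decide) (by decide)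
    (by decide) (by decide)
  have hpos : ∀ᵐ ω ∂P, 0 < E 0 ω ∧ 0 < E 1 ω ∧ 0 < E 2 ω ∧ 0 < E 3 ω := by
    filter_upwards [aux_pos (hexp 0), aux_pos (hexp 1), aux_pos (hexp 2), aux_pos (hexp 3)]
      with ω h1 h2 h3 h4 using ⟨h1, h2, h3, h4⟩
  rw [integral_eq_lintegral_of_nonneg_ae]
  · have e : ∫⁻ ω, ENNReal.ofReal ((min (E 0 ω / a) (E 2 ω / b) + min (E 1 ω / a) (E 3 ω / b))
        / ((E 0 ω + E 1 ω) * (E 2 ω + E 3 ω))) ∂P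
        = ENNReal.ofReal (auxJ a b) + ENNReal.ofReal (auxJ a b) := by
      nth_rewrite 1 [← h1]
      rw [← h2, ← lintegral_add_left (by fun_prop)]
      refine lintegral_congr_ae ?_
      filter_upwards [hpos] with ω ⟨p0, p1, p2, p3⟩
      rw [← ENNReal.ofReal_add (by positivity) (by positivity), add_div, add_comm (E 1 ω) (E 0 ω),
        add_comm (E 3 ω) (E 2 ω)]
    rw [e, ← ENNReal.ofReal_add hJ hJ, ENNReal.toReal_ofReal (add_nonneg hJ hJ)]
    unfold auxJ
    field_simp
    ring
  · filter_upwards [hpos] with ω ⟨p0, p1, p2, p3⟩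
    simp only [Pi.zero_apply]
    positivity
  · exact Measurable.aestronglyMeasurable (by fun_prop)
end
end
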